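/- Assume M ≥ N, equi-divisible congestion, and (when M > N) μ_N > μ_{N+1}, so that the grand-coalition partition P_G has a unique NE φ_G (up to relabeling of players). If (P_G, φ_G) is stable at β = 0, then there exists a finite threshold β̄ ∈ [0,∞) such that (P_G, φ_G), and hence the grand-coalition partition P_G, is stable at cost β if and only if β ≤ β̄. -/

import Mathlib

open Finset

namespace CG

variable {N M : ℕ}

/-- Number of players choosing link `a` under profile `φ`. -/
def gamma (φ : Fin N → Fin M) (a : Fin M) : ℕ :=
  (Finset.univ.filter fun i => φ i = a).card

/-- Utility of coalition `C` under profile `φ` at per-communication cost `β`. -/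
noncomputable def util (μ : Fin M → ℕ → ℝ) (β : ℝ) (C : Finset (Fin N))
    (φ : Fin N → Fin M) : ℝ :=
  (∑ i ∈ C, μ (φ i) (gamma φ (φ i))) - ((C.card : ℝ) - 1) * β

/-- `P` is a partition of the player set into (nonempty, pairwise disjoint) coalitions. -/
def IsPartition (P : Finset (Finset (Fin N))) : Prop :=
  (∀ C ∈ P, C.Nonempty) ∧
  (∀ C ∈ P, ∀ C' ∈ P, C ≠ C' → Disjoint C C') ∧
  (∀ i : Fin N, ∃ C ∈ P, i ∈ C)

/-- `φ` is a Nash equilibrium for partition `P`: no coalition of `P` can strictly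
improve its utility by unilaterally changing the strategies of its own members. -/
def IsNE (μ : Fin M → ℕ → ℝ) (β : ℝ) (P : Finset (Finset (Fin N)))
    (φ : Fin N → Fin M) : Prop :=
  ∀ C ∈ P, ∀ φ' : Fin N → Fin M, (∀ i ∉ C, φ' i = φ i) →
    util μ β C φ' ≤ util μ β C φ

/-- Pessimal anticipated worth of a coalition `C`. -/
noncomputable def pess (μ : Fin M → ℕ → ℝ) (β : ℝ) (C : Finset (Fin N)) : ℝ :=
  sInf {x : ℝ | ∃ P' : Finset (Finset (Fin N)), ∃ φ' : Fin N → Fin M,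
    IsPartition P' ∧ C ∈ P' ∧ IsNE μ β P' φ' ∧ x = util μ β C φ'}

/-- `ψ` is a payoff vector consistent with `(P, φ)`. -/
def Consistent (μ : Fin M → ℕ → ℝ) (β : ℝ) (P : Finset (Finset (Fin N)))
    (φ : Fin N → Fin M) (ψ : Fin N → ℝ) : Prop :=
  (∀ j, 0 ≤ ψ j) ∧ ∀ C ∈ P, ∑ j ∈ C, ψ j = util μ β C φ

/-- Coalition `C ∉ P` blocks the configuration with payoff vector `ψ`. -/
def Blocks (μ : Fin M → ℕ → ℝ) (β : ℝ) (P : Finset (Finset (Fin N)))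
    (ψ : Fin N → ℝ) (C : Finset (Fin N)) : Prop :=
  C.Nonempty ∧ C ∉ P ∧ ∑ j ∈ C, ψ j < pess μ β C

/-- The configuration `(P, φ, ψ)` is stable. -/
def ConfigStable (μ : Fin M → ℕ → ℝ) (β : ℝ) (P : Finset (Finset (Fin N)))
    (φ : Fin N → Fin M) (ψ : Fin N → ℝ) : Prop :=
  IsPartition P ∧ IsNE μ β P φ ∧ Consistent μ β P φ ψ ∧
    ∀ C : Finset (Fin N), ¬ Blocks μ β P ψ C

/-- The P-NE pair `(P, φ)` is stable. -/
def PairStable (μ : Fin M → ℕ → ℝ) (β : ℝ) (P : Finset (Finset (Fin N)))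
    (φ : Fin N → Fin M) : Prop :=
  ∃ ψ : Fin N → ℝ, ConfigStable μ β P φ ψ

/-- The partition `P` is stable. -/
def PartStable (μ : Fin M → ℕ → ℝ) (β : ℝ) (P : Finset (Finset (Fin N))) : Prop :=
  ∃ φ : Fin N → Fin M, PairStable μ β P φ

/-- The ALC partition, in which every player is a singleton coalition. -/
def ALC (N : ℕ) : Finset (Finset (Fin N)) :=
  Finset.univ.image fun i => ({i} : Finset (Fin N))

/-- `D_C^P = Σ_i q_i(C)/l_i − 1`. -/
noncomputable def Dcoef (P : Finset (Finset (Fin N))) (C : Finset (Fin N)) : ℝ :=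
  (∑ Ci ∈ P, ((Ci ∩ C).card : ℝ) / (Ci.card : ℝ)) - 1

/-- `Γ_C^P(φ) = Σ_i (q_i(C)/l_i) ν_{C_i}^{0,P}(φ) − ν̲_C^0`. -/
noncomputable def Gam (μ : Fin M → ℕ → ℝ) (P : Finset (Finset (Fin N)))
    (φ : Fin N → Fin M) (C : Finset (Fin N)) : ℝ :=
  (∑ Ci ∈ P, ((Ci ∩ C).card : ℝ) / (Ci.card : ℝ) * util μ 0 Ci φ) - pess μ 0 C

/-- `B^{--}`. -/
def Bmm (μ : Fin M → ℕ → ℝ) (P : Finset (Finset (Fin N))) (φ : Fin N → Fin M) :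
    Set (Finset (Fin N)) :=
  {C | (C.Nonempty ∧ C ∉ P) ∧ Dcoef P C ≤ 0 ∧ Gam μ P φ C < 0}

/-- `B^{+-}`. -/
def Bpm (μ : Fin M → ℕ → ℝ) (P : Finset (Finset (Fin N))) (φ : Fin N → Fin M) :
    Set (Finset (Fin N)) :=
  {C | (C.Nonempty ∧ C ∉ P) ∧ 0 < Dcoef P C ∧ Gam μ P φ C < 0}

/-- `B^{-+}`. -/
def Bmp (μ : Fin M → ℕ → ℝ) (P : Finset (Finset (Fin N))) (φ : Fin N → Fin M) :
    Set (Finset (Fin N)) :=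
  {C | (C.Nonempty ∧ C ∉ P) ∧ Dcoef P C < 0 ∧ 0 ≤ Gam μ P φ C}

/-- `β̄_u^P(φ) = min_{C ∈ B^{-+}} (−Γ_C^P(φ)/D_C^P)`, with `min ∅ = +∞` (in `EReal`). -/
noncomputable def betaU (μ : Fin M → ℕ → ℝ) (P : Finset (Finset (Fin N)))
    (φ : Fin N → Fin M) : EReal :=
  sInf ((fun C => ((-(Gam μ P φ C) / Dcoef P C : ℝ) : EReal)) '' Bmp μ P φ)

/-- `β̄_d^P(φ) = max_{C ∈ B^{+-}} (−Γ_C^P(φ)/D_C^P)`, with `max ∅ = 0` (in `EReal`). -/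
noncomputable def betaD (μ : Fin M → ℕ → ℝ) (P : Finset (Finset (Fin N)))
    (φ : Fin N → Fin M) : EReal :=
  sSup (insert (0 : EReal)
    ((fun C => ((-(Gam μ P φ C) / Dcoef P C : ℝ) : EReal)) '' Bpm μ P φ))

end CG

namespace CG

lemma util_eq_util_zero_sub {N M : ℕ} (μ : Fin M → ℕ → ℝ) (β : ℝ) (C : Finset (Fin N))
    (φ : Fin N → Fin M) : util μ β C φ = util μ 0 C φ - ((C.card : ℝ) - 1) * β := by
  simp [util]

lemma isNE_iff_isNE_zero {N M : ℕ} (μ : Fin M → ℕ → ℝ) (β : ℝ) (P : Finset (Finset (Fin N)))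
    (φ : Fin N → Fin M) : IsNE μ β P φ ↔ IsNE μ 0 P φ := by
  simp only [IsNE, util_eq_util_zero_sub μ β, sub_le_sub_iff_right]

/-- The pessimal anticipated worth is affine in the communication cost. This includes the case
where no equilibrium exists, in which it is constantly zero. -/
lemma pess_affine {N M : ℕ} (μ : Fin M → ℕ → ℝ) (C : Finset (Fin N)) :
    ∃ a b : ℝ, ∀ β, pess μ β C = a + b * β := by
  let S : ℝ → Set ℝ := fun β ↦ {x : ℝ | ∃ P' : Finset (Finset (Fin N)), ∃ φ' : Fin N → Fin M,
    IsPartition P' ∧ C ∈ P' ∧ IsNE μ β P' φ' ∧ x = util μ β C φ'}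
  have hS (β : ℝ) : S β = OrderIso.addRight (-(((C.card : ℝ) - 1) * β)) '' S 0 := by
    ext x
    constructor
    · rintro ⟨P, φ, hP, hC, hNE, rfl⟩
      exact ⟨_, ⟨P, φ, hP, hC, (isNE_iff_isNE_zero μ β P φ).1 hNE, rfl⟩,
        by simp [util_eq_util_zero_sub μ β, sub_eq_add_neg]⟩
    · rintro ⟨_, ⟨P, φ, hP, hC, hNE, rfl⟩, rfl⟩
      exact ⟨P, φ, hP, hC, (isNE_iff_isNE_zero μ β P φ).2 hNE,
        by simp [util_eq_util_zero_sub μ β, sub_eq_add_neg]⟩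
  have hp (β : ℝ) : pess μ β C = sInf (S β) := rfl
  rcases (S 0).eq_empty_or_nonempty with h | h
  · exact ⟨0, 0, fun β ↦ by simp [hp, hS β, h]⟩
  · have hb : BddBelow (S 0) := by
      refine ((Set.finite_range fun φ ↦ util μ 0 C φ).subset ?_).bddBelow
      rintro _ ⟨P, φ, -, -, -, rfl⟩
      exact ⟨φ, rfl⟩
    refine ⟨sInf (S 0), -((C.card : ℝ) - 1), fun β ↦ ?_⟩
    rw [hp, hS β, ← OrderIso.map_csInf' _ h hb]
    simp only [OrderIso.addRight_apply]
    ring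

/-- Cost-payoff pairs that satisfy all stability constraints of the grand coalition with total
reward `V`. -/
def stablePayoffs {N M : ℕ} (μ : Fin M → ℕ → ℝ) (V : ℝ) : Set (ℝ × (Fin N → ℝ)) :=
  {p | 0 ≤ p.1 ∧ (∀ j, 0 ≤ p.2 j) ∧ ∑ j, p.2 j = V - ((N : ℝ) - 1) * p.1 ∧
    ∀ C : Finset (Fin N), C.Nonempty → C ≠ univ → pess μ p.1 C ≤ ∑ j ∈ C, p.2 j}

lemma convex_stablePayoffs {N M : ℕ} (μ : Fin M → ℕ → ℝ) (V : ℝ) :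
    Convex ℝ (stablePayoffs (N := N) μ V) := by
  rintro ⟨x, u⟩ ⟨hx, hu, hxs, hxC⟩ ⟨y, v⟩ ⟨hy, hv, hys, hyC⟩ s t hs ht hst
  dsimp only at *
  refine ⟨?_, fun j ↦ ?_, ?_, fun C hC hCu ↦ ?_⟩
  · simp only [Prod.fst_add, Prod.smul_fst, smul_eq_mul]
    positivity
  · have := hu j
    have := hv j
    simp only [Prod.snd_add, Prod.smul_snd, Pi.add_apply, Pi.smul_apply, smul_eq_mul]
    positivity
  · simp only [Prod.fst_add, Prod.smul_fst, Prod.snd_add, Prod.smul_snd, Pi.add_apply,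
      Pi.smul_apply, smul_eq_mul, sum_add_distrib, ← mul_sum, hxs, hys]
    linear_combination V * hst
  · obtain ⟨a, b, hab⟩ := pess_affine μ C
    have h1 := hxC C hC hCu
    have h2 := hyC C hC hCu
    rw [hab] at h1 h2 ⊢
    simp only [Prod.fst_add, Prod.smul_fst, Prod.snd_add, Prod.smul_snd, Pi.add_apply,
      Pi.smul_apply, smul_eq_mul, sum_add_distrib, ← mul_sum]
    calc a + b * (s * x + t * y) = s * (a + b * x) + t * (a + b * y) := by
          linear_combination (-a) * hst
      _ ≤ _ := by gcongr

lemma isClosed_stablePayoffs {N M : ℕ} (μ : Fin M → ℕ → ℝ) (V : ℝ) :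
    IsClosed (stablePayoffs (N := N) μ V) := by
  choose a b hab using pess_affine (N := N) μ
  simp only [stablePayoffs, hab, Set.ofPred_and, Set.ofPred_forall]
  refine (isClosed_le (by fun_prop) (by fun_prop)).inter
    ((isClosed_iInter fun j ↦ isClosed_le (by fun_prop) (by fun_prop)).inter
      ((isClosed_eq (by fun_prop) (by fun_prop)).inter
        (isClosed_iInter fun C ↦ isClosed_iInter fun _ ↦ isClosed_iInter fun _ ↦
          isClosed_le (by fun_prop) (by fun_prop))))

lemma isCompact_stablePayoffs {N M : ℕ} (hN : 2 ≤ N) (μ : Fin M → ℕ → ℝ) (V : ℝ) :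
    IsCompact (stablePayoffs (N := N) μ V) := by
  have hN' : (2 : ℝ) ≤ N := by exact_mod_cast hN
  refine (isCompact_Icc (a := ((0 : ℝ), (0 : Fin N → ℝ)))
    (b := (V, fun _ ↦ V))).of_isClosed_subset (isClosed_stablePayoffs μ V) ?_
  rintro ⟨x, u⟩ ⟨hx, hu, hs, -⟩
  dsimp only at *
  have hsum : 0 ≤ ∑ j, u j := sum_nonneg fun j _ ↦ hu j
  refine ⟨⟨hx, hu⟩, ⟨show x ≤ V by nlinarith, fun j ↦ ?_⟩⟩
  have : u j ≤ ∑ j, u j := single_le_sum (fun j _ ↦ hu j) (mem_univ j)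
  show u j ≤ V
  nlinarith

/-- Stability of the grand coalition at an equilibrium is a linear feasibility problem. -/
lemma pairStable_grand_iff {N M : ℕ} (μ : Fin M → ℕ → ℝ) {β : ℝ} (hβ : 0 ≤ β)
    {φ : Fin N → Fin M} (hP : IsPartition ({univ} : Finset (Finset (Fin N))))
    (hNE : IsNE μ 0 {univ} φ) :
    PairStable μ β {univ} φ ↔ ∃ ψ : Fin N → ℝ, (β, ψ) ∈ stablePayoffs μ (util μ 0 univ φ) := by
  refine exists_congr fun ψ ↦ ?_
  simp [ConfigStable, Consistent, Blocks, stablePayoffs, hP, hβ, isNE_iff_isNE_zero μ β, hNE,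
    util_eq_util_zero_sub μ β, and_assoc]

lemma IsNE.util_grand_eq {N M : ℕ} {μ : Fin M → ℕ → ℝ} {β : ℝ} {φ φ' : Fin N → Fin M}
    (h : IsNE μ β {univ} φ) (h' : IsNE μ β {univ} φ') : util μ β univ φ = util μ β univ φ' :=
  le_antisymm (h' _ (mem_singleton_self _) _ (by simp)) (h _ (mem_singleton_self _) _ (by simp))

end CG

open CG in
/-- with equi-divisible congestion (and `μ_N > μ_{N+1}` when `M > N`),
if the unique grand-coalition P-NE pair `(P_G, φ_G)` is stable at `β = 0`, there is a
finite threshold `β̄ ≥ 0` with stability (of the pair, and of `P_G`) iff `β ≤ β̄`. -/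
theorem stmt8 {N M : ℕ} (hN : 2 ≤ N) (hMN : N ≤ M)
    (μ : Fin M → ℕ → ℝ)
    (hpos : ∀ a : Fin M, ∀ k : ℕ, 1 ≤ k → k ≤ N → 0 < μ a k)
    (hmono : ∀ a b : Fin M, a ≤ b → μ b 1 ≤ μ a 1)
    (hequi : ∀ a : Fin M, ∀ k : ℕ, 1 ≤ k → μ a k = μ a 1 / k)
    (hgap : ∀ h : N < M, μ (⟨N, h⟩ : Fin M) 1 < μ (Fin.castLE hMN ⟨N - 1, by omega⟩) 1)
    (φG : Fin N → Fin M) (hinj : Function.Injective φG) (htop : ∀ i, (φG i : ℕ) < N)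
    (h0 : PairStable μ 0 ({Finset.univ} : Finset (Finset (Fin N))) φG) :
    ∃ B : ℝ, 0 ≤ B ∧ ∀ β : ℝ, 0 ≤ β →
      (PairStable μ β ({Finset.univ} : Finset (Finset (Fin N))) φG ↔ β ≤ B) ∧
      (PartStable μ β ({Finset.univ} : Finset (Finset (Fin N))) ↔ β ≤ B) := by
  obtain ⟨_, hP, hNE, -⟩ := id h0
  set K := stablePayoffs (N := N) μ (util μ 0 univ φG) with hK
  have hpair (β : ℝ) (hβ : 0 ≤ β) : PairStable μ β {univ} φG ↔ β ∈ Prod.fst '' K := by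
    rw [pairStable_grand_iff μ hβ hP hNE]
    simp [hK]
  have hpart (β : ℝ) : PartStable μ β ({univ} : Finset (Finset (Fin N))) ↔ PairStable μ β {univ} φG := by
    refine ⟨?_, fun h ↦ ⟨φG, h⟩⟩
    rintro ⟨φ, ψ, -, h, hψ, hb⟩
    have hG : IsNE μ β {univ} φG := (isNE_iff_isNE_zero ..).2 hNE
    exact ⟨ψ, hP, hG, ⟨hψ.1, by simpa [hG.util_grand_eq h] using hψ.2⟩, hb⟩
  have h0K : (0 : ℝ) ∈ Prod.fst '' K := (hpair 0 le_rfl).1 h0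
  have hc : IsCompact (Prod.fst '' K) := (isCompact_stablePayoffs hN μ _).image continuous_fst
  have hconv : Convex ℝ (Prod.fst '' K) :=
    (convex_stablePayoffs μ _).linear_image (LinearMap.fst ℝ ℝ (Fin N → ℝ))
  refine ⟨sSup (Prod.fst '' K), le_csSup hc.bddAbove h0K, fun β hβ ↦ ?_⟩
  have key : PairStable μ β {univ} φG ↔ β ≤ sSup (Prod.fst '' K) := by
    rw [hpair β hβ]
    exact ⟨le_csSup hc.bddAbove,
      fun h ↦ hconv.ordConnected.out h0K (hc.sSup_mem ⟨0, h0K⟩) ⟨hβ, h⟩⟩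
  exact ⟨key, (hpart β).trans key⟩
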